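/- Let ε > 0 be a constant and let Δ ≥ 3 and k be positive integers. If p = p(n) satisfies p(n) · n^{2/(Δ+1)} → ∞, then asymptotically almost surely G ~ G(n, p(n)) has the following property: for every vertex subset V′ ⊆ V(G) with |V′| ≥ εn, the induced subgraph G[V′] contains every connected graph on at most (log n)^k vertices with maximum degree at most Δ as a subgraph. -/

import Mathlib

open Finset Filter Real
open scoped Classical

/-- Number of edges of a graph. -/
noncomputable def edgeCount {α : Type*} (G : SimpleGraph α) : ℕ := Nat.card G.edgeSet

/-- The probability that the binomial random graph `G(n,p)` satisfies the property `P`. -/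
noncomputable def gnpProb (n : ℕ) (p : ℝ) (P : SimpleGraph (Fin n) → Prop) : ℝ :=
  ∑ G : SimpleGraph (Fin n),
    if P G then p ^ edgeCount G * (1 - p) ^ (n.choose 2 - edgeCount G) else 0

/-- `H` has maximum degree at most `Δ`. -/
def maxDegLE {β : Type*} (H : SimpleGraph β) (Δ : ℕ) : Prop :=
  ∀ v, Nat.card (H.neighborSet v) ≤ Δ


/-! ### Product measure on subsets -/

/-- Weight of a subset in the `p`-biased product measure. -/
noncomputable def bw {α : Type*} [Fintype α] (p : ℝ) (s : Finset α) : ℝ :=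
  p ^ s.card * (1 - p) ^ (Fintype.card α - s.card)

lemma bw_nonneg {α : Type*} [Fintype α] {p : ℝ} (h0 : 0 ≤ p) (h1 : p ≤ 1) (s : Finset α) :
    0 ≤ bw p s := by
  unfold bw
  have : 0 ≤ 1 - p := by linarith
  positivity

lemma bw_sum {α : Type*} [Fintype α] (p : ℝ) : ∑ s : Finset α, bw p s = 1 := by
  unfold bw
  rw [Fintype.sum_pow_mul_eq_add_pow]
  simp

lemma bw_mod {α : Type*} [Fintype α] (p : ℝ) (s t : Finset α) :
    bw p s * bw p t = bw p (s ∩ t) * bw p (s ∪ t) := by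
  unfold bw
  have h := Finset.card_union_add_card_inter s t
  have h1 := Finset.card_le_univ s
  have h2 := Finset.card_le_univ t
  have h3 := Finset.card_le_univ (s ∪ t)
  have h4 := Finset.card_le_univ (s ∩ t)
  rw [mul_mul_mul_comm, mul_mul_mul_comm (p ^ (s ∩ t).card), ← pow_add, ← pow_add, ← pow_add,
    ← pow_add]
  congr 2 <;> omega

lemma indep_single {α : Type*} [Fintype α] (p : ℝ) (a : α) (G : Finset α → ℝ)
    (hG : ∀ s, G (insert a s) = G s) :
    ∑ s : Finset α, bw p s * ((if a ∈ s then 1 else 0) * G s) = p * ∑ s : Finset α, bw p s * G s := by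
  have hu : (Finset.univ : Finset (Finset α)) = (insert a (Finset.univ.erase a)).powerset := by
    rw [Finset.insert_erase (Finset.mem_univ a), Finset.powerset_univ]
  rw [hu, Finset.sum_powerset_insert (Finset.notMem_erase a _),
    Finset.sum_powerset_insert (Finset.notMem_erase a _), ← Finset.sum_add_distrib,
    ← Finset.sum_add_distrib, Finset.mul_sum]
  refine Finset.sum_congr rfl fun t ht => ?_
  have hat : a ∉ t := fun h => Finset.notMem_erase a _ (Finset.mem_powerset.1 ht h)
  have hc : t.card + 1 ≤ Fintype.card α := by
    rw [← Finset.card_insert_of_notMem hat]; exact Finset.card_le_univ _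
  obtain ⟨d, hd⟩ := Nat.exists_eq_add_of_le hc
  have e1 : Fintype.card α - t.card = d + 1 := by omega
  have e2 : Fintype.card α - (t.card + 1) = d := by omega
  simp only [hat, if_false, hG, Finset.mem_insert_self, if_true, bw,
    Finset.card_insert_of_notMem hat, e1, e2]
  ring

lemma indep_set {α : Type*} [Fintype α] (p : ℝ) (A : Finset α) (G : Finset α → ℝ)
    (hG : ∀ a ∈ A, ∀ s, G (insert a s) = G s) :
    ∑ s : Finset α, bw p s * ((if A ⊆ s then 1 else 0) * G s)
      = p ^ A.card * ∑ s : Finset α, bw p s * G s := by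
  induction A using Finset.induction_on with
  | empty => simp
  | insert a A ha ih =>
    have h1 := indep_single p a (fun s => (if A ⊆ s then 1 else 0) * G s) (by
      intro s
      simp only [hG a (Finset.mem_insert_self _ _), Finset.subset_insert_iff_of_notMem ha])
    rw [ih (fun b hb => hG b (Finset.mem_insert_of_mem hb))] at h1
    rw [Finset.card_insert_of_notMem ha, pow_succ', mul_assoc, ← h1]
    refine Finset.sum_congr rfl fun s _ => ?_
    congr 1
    rw [← mul_assoc]
    congr 1
    by_cases h1 : a ∈ s <;> by_cases h2 : A ⊆ s <;> simp [Finset.insert_subset_iff, h1, h2]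

lemma harris {α : Type*} [Fintype α] {p : ℝ} (h0 : 0 ≤ p) (h1 : p ≤ 1) (A : Finset α)
    (f g : Finset α → ℝ) (hf : ∀ s, 0 ≤ f s) (hg : ∀ s, 0 ≤ g s) (hf' : Antitone f)
    (hg' : Antitone g) :
    (∑ s : Finset α, bw p s * ((if A ⊆ s then 1 else 0) * f s)) *
      (∑ s : Finset α, bw p s * ((if A ⊆ s then 1 else 0) * g s)) ≤
    p ^ A.card *
      (∑ s : Finset α, bw p s * ((if A ⊆ s then 1 else 0) * (f s * g s))) := by
  have hA : ∑ s : Finset α, bw p s * (if A ⊆ s then 1 else 0) = p ^ A.card := by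
    have := indep_set p A (fun _ => 1) (fun _ _ _ => rfl)
    simpa [bw_sum] using this
  have key := fkg (α := (Finset α)ᵒᵈ) (β := ℝ)
    (fun s => f (OrderDual.ofDual s)) (fun s => g (OrderDual.ofDual s))
    (fun s => bw p (OrderDual.ofDual s) * (if A ⊆ OrderDual.ofDual s then 1 else 0))
    (by
      intro s
      have := bw_nonneg h0 h1 (OrderDual.ofDual s)
      simp only [Pi.zero_apply]
      split_ifs <;> simp [this])
    (fun s => hf _) (fun s => hg _) (fun s t h => hf' h) (fun s t h => hg' h)
    (by
      intro s t
      have h := bw_mod p (OrderDual.ofDual s) (OrderDual.ofDual t)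
      have n1 := bw_nonneg h0 h1 (OrderDual.ofDual s ∩ OrderDual.ofDual t)
      have n2 := bw_nonneg h0 h1 (OrderDual.ofDual s ∪ OrderDual.ofDual t)
      change _ ≤ (bw p (OrderDual.ofDual s ∪ OrderDual.ofDual t) *
        (if A ⊆ OrderDual.ofDual s ∪ OrderDual.ofDual t then 1 else 0)) *
        (bw p (OrderDual.ofDual s ∩ OrderDual.ofDual t) *
        (if A ⊆ OrderDual.ofDual s ∩ OrderDual.ofDual t then 1 else 0))
      by_cases c1 : A ⊆ OrderDual.ofDual s
      · by_cases c2 : A ⊆ OrderDual.ofDual t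
        · rw [if_pos c1, if_pos c2, if_pos (c1.trans Finset.subset_union_left),
            if_pos (Finset.subset_inter c1 c2)]
          linarith
        · rw [if_neg c2]
          simp only [mul_zero]
          split_ifs <;> simp <;> positivity
      · rw [if_neg c1]
        simp only [mul_zero, zero_mul]
        split_ifs <;> simp <;> positivity)
  rw [← hA]
  have conv : ∀ F : Finset α → ℝ, ∑ s : (Finset α)ᵒᵈ, F (OrderDual.ofDual s) = ∑ s, F s :=
    fun F => Equiv.sum_comp (OrderDual.ofDual (α := Finset α)) F
  rw [conv (fun s => bw p s * (if A ⊆ s then 1 else 0)),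
    conv (fun s => bw p s * (if A ⊆ s then 1 else 0) * f s),
    conv (fun s => bw p s * (if A ⊆ s then 1 else 0) * g s)] at key
  have c4 := conv (fun s => bw p s * (if A ⊆ s then 1 else 0) * (f s * g s))
  rw [c4] at key
  simpa only [mul_assoc] using key

/-- The function `∏ (1 - q 1[A i ⊆ s])`. -/
noncomputable def avoidF {α ι : Type*} (A : ι → Finset α) (q : ℝ) (S : Finset ι)
    (s : Finset α) : ℝ :=
  ∏ i ∈ S, (1 - q * (if A i ⊆ s then 1 else 0))

lemma avoidF_factor {α ι : Type*} (A : ι → Finset α) {q : ℝ} (hq0 : 0 ≤ q) (hq1 : q ≤ 1)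
    (i : ι) (s : Finset α) :
    0 ≤ 1 - q * (if A i ⊆ s then 1 else 0) ∧ 1 - q * (if A i ⊆ s then (1:ℝ) else 0) ≤ 1 := by
  split_ifs <;> constructor <;> linarith

lemma avoidF_nonneg {α ι : Type*} (A : ι → Finset α) {q : ℝ} (hq0 : 0 ≤ q) (hq1 : q ≤ 1)
    (S : Finset ι) (s : Finset α) : 0 ≤ avoidF A q S s :=
  Finset.prod_nonneg fun i _ => (avoidF_factor A hq0 hq1 i s).1

lemma avoidF_anti {α ι : Type*} (A : ι → Finset α) {q : ℝ} (hq0 : 0 ≤ q) (hq1 : q ≤ 1)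
    (S : Finset ι) : Antitone (avoidF A q S) := by
  intro s t hst
  refine Finset.prod_le_prod (fun i _ => (avoidF_factor A hq0 hq1 i t).1) fun i _ => ?_
  have : (if A i ⊆ s then (1:ℝ) else 0) ≤ if A i ⊆ t then 1 else 0 := by
    by_cases h : A i ⊆ s
    · rw [if_pos h, if_pos (h.trans hst)]
    · rw [if_neg h]; split_ifs <;> norm_num
  nlinarith

lemma avoidF_ge {α ι : Type*} (A : ι → Finset α) {q : ℝ} (hq0 : 0 ≤ q) (hq1 : q ≤ 1)
    (S : Finset ι) (s : Finset α) :
    1 - q * ∑ i ∈ S, (if A i ⊆ s then (1:ℝ) else 0) ≤ avoidF A q S s := by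
  induction S using Finset.induction_on with
  | empty => simp [avoidF]
  | insert a S ha ih =>
    rw [Finset.sum_insert ha]
    have h1 : avoidF A q (insert a S) s
        = (1 - q * (if A a ⊆ s then 1 else 0)) * avoidF A q S s := by
      simp [avoidF, Finset.prod_insert ha]
    rw [h1]
    have h2 : avoidF A q S s ≤ 1 :=
      Finset.prod_le_one (fun i _ => (avoidF_factor A hq0 hq1 i s).1)
        (fun i _ => (avoidF_factor A hq0 hq1 i s).2)
    split_ifs <;> nlinarith

/-- Janson's inequality, Laplace-transform-like form. -/
lemma janson_aux {α ι : Type*} [Fintype α] {p : ℝ} (h0 : 0 ≤ p) (h1 : p ≤ 1)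
    (A : ι → Finset α) {q : ℝ} (hq0 : 0 ≤ q) (hq1 : q ≤ 1) (S : Finset ι) :
    ∑ s : Finset α, bw p s * avoidF A q S s ≤
      Real.exp (- q * ∑ i ∈ S, p ^ (A i).card + q ^ 2 / 2 *
        ∑ i ∈ S, ∑ j ∈ S, if Disjoint (A i) (A j) then 0 else p ^ (A i ∪ A j).card) := by
  induction S using Finset.induction_on with
  | empty => simp [avoidF, bw_sum]
  | insert k S hk ih =>
    set Y := S.filter (fun j => ¬ Disjoint (A k) (A j)) with hY
    set Z := S.filter (fun j => Disjoint (A k) (A j)) with hZ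
    set Ps := ∑ s : Finset α, bw p s * avoidF A q S s with hPs
    have hPs0 : 0 ≤ Ps := Finset.sum_nonneg fun s _ =>
      mul_nonneg (bw_nonneg h0 h1 s) (avoidF_nonneg A hq0 hq1 S s)
    have hsplit : ∀ s, avoidF A q Y s * avoidF A q Z s = avoidF A q S s := by
      intro s
      unfold avoidF
      rw [mul_comm]
      exact Finset.prod_filter_mul_prod_filter_not S _ _
    -- the first-order term
    set T := ∑ j ∈ S, if Disjoint (A k) (A j) then 0 else p ^ (A k ∪ A j).card with hT
    set B := ∑ s : Finset α, bw p s * ((if A k ⊆ s then 1 else 0) * avoidF A q S s) with hB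
    have hpk : 0 ≤ p ^ (A k).card := by positivity
    have hB1 : (p ^ (A k).card - q * T) * Ps ≤ B := by
      have hZind : ∑ s : Finset α, bw p s * ((if A k ⊆ s then 1 else 0) * avoidF A q Z s)
          = p ^ (A k).card * ∑ s : Finset α, bw p s * avoidF A q Z s := by
        apply indep_set
        intro a ha s
        unfold avoidF
        refine Finset.prod_congr rfl fun j hj => ?_
        have hd : Disjoint (A k) (A j) := (Finset.mem_filter.1 hj).2
        have : a ∉ A j := Finset.disjoint_left.1 hd ha
        simp only [Finset.subset_insert_iff_of_notMem this]
      have hZge : Ps ≤ ∑ s : Finset α, bw p s * avoidF A q Z s := by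
        refine Finset.sum_le_sum fun s _ => mul_le_mul_of_nonneg_left ?_ (bw_nonneg h0 h1 s)
        rw [← hsplit]
        have hy : avoidF A q Y s ≤ 1 :=
          Finset.prod_le_one (fun i _ => (avoidF_factor A hq0 hq1 i s).1)
            (fun i _ => (avoidF_factor A hq0 hq1 i s).2)
        have := avoidF_nonneg A hq0 hq1 Z s
        nlinarith
      have hYge : p ^ (A k).card - q * T ≤
          ∑ s : Finset α, bw p s * ((if A k ⊆ s then 1 else 0) * avoidF A q Y s) := by
        have e1 : p ^ (A k).card - q * T = ∑ s : Finset α, bw p s * ((if A k ⊆ s then 1 else 0) *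
            (1 - q * ∑ i ∈ Y, (if A i ⊆ s then (1:ℝ) else 0))) := by
          have hU : ∀ C : Finset α, ∑ s : Finset α, bw p s * (if C ⊆ s then 1 else 0)
              = p ^ C.card := by
            intro C
            have := indep_set p C (fun _ => 1) (fun _ _ _ => rfl)
            simpa [bw_sum] using this
          have hT' : T = ∑ j ∈ Y, p ^ (A k ∪ A j).card := by
            rw [hT, hY, Finset.sum_filter]
            refine Finset.sum_congr rfl fun j _ => ?_
            by_cases h : Disjoint (A k) (A j) <;> simp [h]
          rw [hT', ← hU (A k), Finset.mul_sum]
          simp_rw [← hU, Finset.mul_sum, mul_sub, Finset.mul_sum]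
          rw [Finset.sum_sub_distrib, Finset.sum_comm]
          congr 1
          · simp
          · refine Finset.sum_congr rfl fun s _ => Finset.sum_congr rfl fun j _ => ?_
            by_cases c1 : A k ⊆ s <;> by_cases c2 : A j ⊆ s <;>
              simp [Finset.union_subset_iff, c1, c2]
            ring
        rw [e1]
        refine Finset.sum_le_sum fun s _ => mul_le_mul_of_nonneg_left ?_ (bw_nonneg h0 h1 s)
        refine mul_le_mul_of_nonneg_left (avoidF_ge A hq0 hq1 Y s) ?_
        split_ifs <;> norm_num
      have hH := harris h0 h1 (A k) (avoidF A q Y) (avoidF A q Z) (avoidF_nonneg A hq0 hq1 Y)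
        (avoidF_nonneg A hq0 hq1 Z) (avoidF_anti A hq0 hq1 Y) (avoidF_anti A hq0 hq1 Z)
      simp_rw [hsplit] at hH
      rw [hZind, ← hB] at hH
      set EY := ∑ s : Finset α, bw p s * ((if A k ⊆ s then 1 else 0) * avoidF A q Y s)
      set EZ := ∑ s : Finset α, bw p s * avoidF A q Z s
      have hEY : 0 ≤ EY := Finset.sum_nonneg fun s _ => mul_nonneg (bw_nonneg h0 h1 s)
        (mul_nonneg (by split_ifs <;> norm_num) (avoidF_nonneg A hq0 hq1 Y s))
      have hB0 : 0 ≤ B := Finset.sum_nonneg fun s _ => mul_nonneg (bw_nonneg h0 h1 s)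
        (mul_nonneg (by split_ifs <;> norm_num) (avoidF_nonneg A hq0 hq1 S s))
      have hT0 : 0 ≤ T := Finset.sum_nonneg fun j _ => by split_ifs <;> positivity
      rcases hpk.eq_or_lt with hz | hpos
      · rw [← hz]
        have : 0 ≤ q * T * Ps := by positivity
        linarith
      · have h3 : EY * EZ ≤ B := by
          have : p ^ (A k).card * (EY * EZ) ≤ p ^ (A k).card * B := by linarith
          exact le_of_mul_le_mul_left this hpos
        calc _ ≤ EY * Ps := mul_le_mul_of_nonneg_right hYge hPs0
          _ ≤ EY * EZ := mul_le_mul_of_nonneg_left hZge hEY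
          _ ≤ B := h3
    have hstep : ∑ s : Finset α, bw p s * avoidF A q (insert k S) s = Ps - q * B := by
      rw [hPs, hB, Finset.mul_sum, ← Finset.sum_sub_distrib]
      refine Finset.sum_congr rfl fun s _ => ?_
      simp only [avoidF, Finset.prod_insert hk]
      ring
    rw [hstep, Finset.sum_insert hk, Finset.sum_insert hk, Finset.sum_insert hk]
    have hsum : ∑ i ∈ S, ∑ j ∈ insert k S,
        (if Disjoint (A i) (A j) then 0 else p ^ (A i ∪ A j).card)
        = T + ∑ i ∈ S, ∑ j ∈ S, if Disjoint (A i) (A j) then 0 else p ^ (A i ∪ A j).card := by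
      rw [hT, ← Finset.sum_add_distrib]
      refine Finset.sum_congr rfl fun i _ => ?_
      rw [Finset.sum_insert hk]
      simp only [disjoint_comm, Finset.union_comm]
    rw [hsum]
    set D := ∑ i ∈ S, ∑ j ∈ S, if Disjoint (A i) (A j) then 0 else p ^ (A i ∪ A j).card
    set M := ∑ i ∈ S, p ^ (A i).card
    set d := (if Disjoint (A k) (A k) then 0 else p ^ (A k ∪ A k).card) with hd
    have hd0 : 0 ≤ d := by rw [hd]; split_ifs <;> positivity
    calc Ps - q * B ≤ Ps * (1 + (- q * p ^ (A k).card + q ^ 2 * T)) := by nlinarith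
      _ ≤ Real.exp (- q * M + q ^ 2 / 2 * D) * Real.exp (- q * p ^ (A k).card + q ^ 2 * T) := by
        refine mul_le_mul ih ?_ ?_ (Real.exp_nonneg _) |>.trans le_rfl
        · have := Real.add_one_le_exp (- q * p ^ (A k).card + q ^ 2 * T)
          linarith
        · have h4 : q * p ^ (A k).card ≤ 1 := by
            have := pow_le_one₀ h0 h1 (n := (A k).card)
            nlinarith
          have hT0 : 0 ≤ T := Finset.sum_nonneg fun j _ => by split_ifs <;> positivity
          have : 0 ≤ q ^ 2 * T := by positivity
          linarith
      _ ≤ _ := by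
        rw [← Real.exp_add]
        apply Real.exp_le_exp.2
        have : 0 ≤ q ^ 2 / 2 * d := by positivity
        linarith

/-- Janson's inequality. -/
lemma janson {α ι : Type*} [Fintype α] [Fintype ι] {p : ℝ} (h0 : 0 < p) (h1 : p ≤ 1)
    (A : ι → Finset α) (hA : ∀ i, (A i).Nonempty) {K : ℝ} (hK : 0 < K)
    (hKD : K * ∑ i, ∑ j, (if Disjoint (A i) (A j) then 0 else p ^ (A i ∪ A j).card)
      ≤ (∑ i, p ^ (A i).card) ^ 2) (hι : Nonempty ι) :
    ∑ s : Finset α, (if ∀ i, ¬ A i ⊆ s then bw p s else 0) ≤ Real.exp (- (K / 2)) := by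
  set M := ∑ i, p ^ (A i).card with hM
  set D := ∑ i, ∑ j, (if Disjoint (A i) (A j) then 0 else p ^ (A i ∪ A j).card) with hD
  have hMpos : 0 < M := Finset.sum_pos (fun i _ => by positivity) Finset.univ_nonempty
  have hDM : M ≤ D := by
    refine Finset.sum_le_sum fun i _ => ?_
    have : p ^ (A i).card = if Disjoint (A i) (A i) then 0 else p ^ (A i ∪ A i).card := by
      rw [if_neg, Finset.union_self]
      rw [disjoint_self]
      exact (hA i).ne_empty
    rw [this]
    refine Finset.single_le_sum (f := fun j =>
      if Disjoint (A i) (A j) then 0 else p ^ (A i ∪ A j).card) (fun j _ => ?_) (Finset.mem_univ i)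
    split_ifs <;> positivity
  have hKM : K ≤ M := by
    have : K * M ≤ M * M := by nlinarith
    exact le_of_mul_le_mul_right this hMpos
  have hq0 : 0 ≤ K / M := by positivity
  have hq1 : K / M ≤ 1 := by rw [div_le_one hMpos]; exact hKM
  have hj := janson_aux h0.le h1 A hq0 hq1 Finset.univ
  refine le_trans (Finset.sum_le_sum fun s _ => ?_) (hj.trans ?_)
  · split_ifs with h
    · have : avoidF A (K / M) Finset.univ s = 1 := by
        unfold avoidF
        refine Finset.prod_eq_one fun i _ => ?_
        simp [h i]
      rw [this, mul_one]
    · exact mul_nonneg (bw_nonneg h0.le h1 s) (avoidF_nonneg A hq0 hq1 _ s)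
  · apply Real.exp_le_exp.2
    rw [← hM, ← hD]
    have e1 : K / M * M = K := by field_simp
    have e2 : (K / M) ^ 2 / 2 * D = K * (K * D) / (2 * M ^ 2) := by field_simp
    have e3 : K * (K * D) / (2 * M ^ 2) ≤ K / 2 := by
      rw [div_le_iff₀ (by positivity)]
      nlinarith
    rw [e2]
    linarith

/-- Janson's inequality, for arbitrary decidability instances. -/
lemma janson_dec {α ι : Type*} [Fintype α] [Fintype ι] [dα : DecidableEq α] {p : ℝ}
    (h0 : 0 < p) (h1 : p ≤ 1)
    (A : ι → Finset α) [d1 : ∀ i j, Decidable (Disjoint (A i) (A j))]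
    [d2 : DecidablePred fun s : Finset α => ∀ i, ¬ A i ⊆ s]
    (hA : ∀ i, (A i).Nonempty) {K : ℝ} (hK : 0 < K)
    (hKD : K * ∑ i, ∑ j, (if Disjoint (A i) (A j) then 0 else p ^ (A i ∪ A j).card)
      ≤ (∑ i, p ^ (A i).card) ^ 2) (hι : Nonempty ι) :
    ∑ s : Finset α, (if ∀ i, ¬ A i ⊆ s then bw p s else 0) ≤ Real.exp (- (K / 2)) := by
  have hj := janson h0 h1 A hA hK (by convert hKD) hι
  convert hj

/-! ### Transfer to the random graph -/

/-- Non-diagonal pairs. -/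
abbrev Ed (n : ℕ) : Type := {e : Sym2 (Fin n) // ¬ e.IsDiag}

/-- Graphs correspond to sets of non-diagonal pairs. -/
noncomputable def graphEquiv (n : ℕ) : Finset (Ed n) ≃ SimpleGraph (Fin n) where
  toFun s := SimpleGraph.fromEdgeSet {e | ∃ h : ¬ e.IsDiag, (⟨e, h⟩ : Ed n) ∈ s}
  invFun G := Finset.univ.filter (fun e => e.1 ∈ G.edgeSet)
  left_inv s := by
    ext e
    rcases e with ⟨e, he⟩
    simp [SimpleGraph.edgeSet_fromEdgeSet, he]
  right_inv G := by
    ext a b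
    simp only [SimpleGraph.fromEdgeSet_adj, Finset.mem_filter, Finset.mem_univ, true_and,
      Set.mem_ofPred_eq, SimpleGraph.mem_edgeSet, exists_prop, Sym2.mk_isDiag_iff]
    constructor
    · rintro ⟨⟨_, h⟩, _⟩
      exact h
    · intro h
      exact ⟨⟨h.ne, h⟩, h.ne⟩

lemma graphEquiv_edgeSet (n : ℕ) (s : Finset (Ed n)) (e : Sym2 (Fin n)) :
    e ∈ (graphEquiv n s).edgeSet ↔ ∃ h : ¬ e.IsDiag, (⟨e, h⟩ : Ed n) ∈ s := by
  simp only [graphEquiv, Equiv.coe_fn_mk, SimpleGraph.edgeSet_fromEdgeSet, Set.mem_sdiff,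
    Set.mem_ofPred_eq]
  constructor
  · exact fun h => h.1
  · rintro ⟨h, h'⟩
    exact ⟨⟨h, h'⟩, by simpa using h⟩

lemma graphEquiv_edgeCount (n : ℕ) (s : Finset (Ed n)) :
    edgeCount (graphEquiv n s) = s.card := by
  unfold edgeCount
  have : (graphEquiv n s).edgeSet = ((s.map (Function.Embedding.subtype _) :
      Finset (Sym2 (Fin n))) : Set (Sym2 (Fin n))) := by
    ext e
    rw [graphEquiv_edgeSet]
    simp
  rw [this, Nat.card_coe_set_eq, Set.ncard_coe_finset, Finset.card_map]

lemma gnpProb_eq (n : ℕ) (p : ℝ) (P : SimpleGraph (Fin n) → Prop) :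
    gnpProb n p P = ∑ s : Finset (Ed n), if P (graphEquiv n s) then bw p s else 0 := by
  unfold gnpProb
  rw [← Equiv.sum_comp (graphEquiv n)]
  refine Finset.sum_congr rfl fun s _ => ?_
  have : Fintype.card (Ed n) = n.choose 2 := by
    have h := Sym2.card_subtype_not_diag (α := Fin n)
    rw [Fintype.card_fin] at h
    rw [← h]
  rw [graphEquiv_edgeCount, bw, this]

/-- Number of edges of `H` inside `U`. -/
noncomputable def eIn {h : ℕ} (H : SimpleGraph (Fin h)) (U : Finset (Fin h)) : ℕ :=
  (Finset.univ.filter (fun e : Sym2 (Fin h) => e ∈ H.edgeSet ∧ ∀ v ∈ e, v ∈ U)).card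

/-- Image of the edges of `H` inside `U`. -/
noncomputable def imgE {h n : ℕ} (H : SimpleGraph (Fin h)) (φ : Fin h → Fin n)
    (U : Finset (Fin h)) : Finset (Ed n) :=
  Finset.univ.filter (fun e => ∃ a b, H.Adj a b ∧ a ∈ U ∧ b ∈ U ∧ e.1 = s(φ a, φ b))

lemma card_imgE {h n : ℕ} (H : SimpleGraph (Fin h)) (φ : Fin h → Fin n)
    (hφ : Function.Injective φ) (U : Finset (Fin h)) : (imgE H φ U).card = eIn H U := by
  symm
  unfold eIn
  have hmem : ∀ e : Sym2 (Fin h), e ∈ H.edgeSet → ¬ (Sym2.map φ e).IsDiag := by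
    intro e
    induction e with
    | _ a b =>
      intro he
      simp only [Sym2.map_mk, Sym2.mk_isDiag_iff]
      exact fun hab => (SimpleGraph.mem_edgeSet _ |>.1 he).ne (hφ hab)
  refine Finset.card_bij (fun e he => (⟨Sym2.map φ e, hmem e (Finset.mem_filter.1 he).2.1⟩ : Ed n))
    ?_ ?_ ?_
  · intro e he
    have he' := (Finset.mem_filter.1 he).2
    simp only [imgE, Finset.mem_filter, Finset.mem_univ, true_and]
    clear he
    induction e with
    | _ a b =>
      exact ⟨a, b, he'.1, he'.2 a (by simp), he'.2 b (by simp), by simp⟩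
  · intro e1 h1 e2 h2 h12
    exact Sym2.map.injective hφ (congrArg Subtype.val h12)
  · intro e he
    simp only [imgE, Finset.mem_filter, Finset.mem_univ, true_and] at he
    obtain ⟨a, b, hab, ha, hb, he⟩ := he
    refine ⟨s(a, b), ?_, ?_⟩
    · simp only [Finset.mem_filter, Finset.mem_univ, true_and, SimpleGraph.mem_edgeSet]
      refine ⟨hab, fun v hv => ?_⟩
      rcases Sym2.mem_iff.1 hv with rfl | rfl <;> assumption
    · apply Subtype.ext
      simp [he]

/-- Existence of an embedding. -/
def HasEmb {n h : ℕ} (V' : Finset (Fin n)) (H : SimpleGraph (Fin h))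
    (G : SimpleGraph (Fin n)) : Prop :=
  ∃ f : Fin h → Fin n, Function.Injective f ∧ (∀ a, f a ∈ V') ∧
    ∀ a b, H.Adj a b → G.Adj (f a) (f b)

lemma count_agree {h N : ℕ} (U : Finset (Fin h)) (x : Fin h → Fin N) :
    (Finset.univ.filter (fun y : Fin h → Fin N => ∀ v ∈ U, x v = y v)).card
      = N ^ (h - U.card) := by
  have : Finset.univ.filter (fun y : Fin h → Fin N => ∀ v ∈ U, x v = y v)
      = Fintype.piFinset (fun v => if v ∈ U then {x v} else Finset.univ) := by
    ext y
    simp only [Finset.mem_filter, Finset.mem_univ, true_and, Fintype.mem_piFinset]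
    refine forall_congr' fun v => ?_
    by_cases hv : v ∈ U <;> simp [hv, eq_comm]
  rw [this, Fintype.card_piFinset]
  have h2 : ∀ v, (if v ∈ U then ({x v} : Finset (Fin N)) else Finset.univ).card
      = if v ∈ U then 1 else N := by
    intro v
    split_ifs <;> simp
  simp_rw [h2]
  rw [Finset.prod_ite]
  simp only [Finset.prod_const_one, one_mul, Finset.prod_const]
  congr 1
  rw [Finset.filter_not, Finset.card_sdiff_of_subset (Finset.filter_subset _ _)]
  simp

set_option maxHeartbeats 400000 in
lemma embed_fail {n h N : ℕ} {p K : ℝ} (h0 : 0 < p) (h1 : p ≤ 1) (hN : 1 ≤ N) (hK : 0 < K)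
    (H : SimpleGraph (Fin h)) (V' : Finset (Fin n)) (hV : h * N ≤ V'.card)
    (hsum : K * ∑ U ∈ (Finset.univ : Finset (Finset (Fin h))).filter (fun U => 1 ≤ eIn H U),
      ((N : ℝ) ^ U.card * p ^ eIn H U)⁻¹ ≤ 1) :
    gnpProb n p (fun G => ¬ HasEmb V' H G) ≤ Real.exp (- (K / 2)) := by
  -- the vertex classes
  obtain ⟨g, hgV⟩ : ∃ g : Fin h × Fin N ↪ Fin n, ∀ z, g z ∈ V' := by
    have : Nonempty (Fin h × Fin N ↪ V') := by
      apply Function.Embedding.nonempty_of_card_le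
      simpa using hV
    obtain ⟨g⟩ := this
    exact ⟨g.trans (Function.Embedding.subtype _), fun z => (g z).2⟩
  set φ : (Fin h → Fin N) → Fin h → Fin n := fun x v => g (v, x v) with hφ
  have hφi : ∀ x, Function.Injective (φ x) := by
    intro x a b hab
    have := g.injective hab
    exact (Prod.mk.inj this).1
  set A : (Fin h → Fin N) → Finset (Ed n) := fun x => imgE H (φ x) Finset.univ with hA
  have hAemb : ∀ x s, A x ⊆ s → HasEmb V' H (graphEquiv n s) := by
    intro x s hs
    refine ⟨φ x, hφi x, fun a => hgV _, fun a b hab => ?_⟩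
    rw [← SimpleGraph.mem_edgeSet, graphEquiv_edgeSet]
    have hd : ¬ (s(φ x a, φ x b)).IsDiag := by
      simp only [Sym2.mk_isDiag_iff]
      exact fun hh => hab.ne (hφi x hh)
    refine ⟨hd, hs ?_⟩
    simp only [hA, imgE, Finset.mem_filter, Finset.mem_univ, true_and]
    exact ⟨a, b, hab, rfl⟩
  have : NeZero N := ⟨by omega⟩
  have hle : gnpProb n p (fun G => ¬ HasEmb V' H G) ≤
      ∑ s : Finset (Ed n), (if ∀ x, ¬ A x ⊆ s then bw p s else 0) := by
    rw [gnpProb_eq]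
    refine Finset.sum_le_sum fun s _ => ?_
    by_cases hs : HasEmb V' H (graphEquiv n s)
    · rw [if_neg (not_not.2 hs)]
      split_ifs
      · exact bw_nonneg h0.le h1 s
      · exact le_rfl
    · rw [if_pos hs, if_pos]
      exact fun x hx => hs (hAemb x s hx)
  by_cases hE : eIn H Finset.univ = 0
  · refine hle.trans (le_trans (le_of_eq ?_) (Real.exp_nonneg _))
    refine Finset.sum_eq_zero fun s _ => ?_
    rw [if_neg]
    push Not
    refine ⟨fun _ => 0, ?_⟩
    have : A (fun _ => 0) = ∅ := by
      rw [← Finset.card_eq_zero, hA]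
      simp only [card_imgE H _ (hφi _), hE]
    rw [this]
    exact Finset.empty_subset _
  refine hle.trans ?_
  set E := eIn H Finset.univ with hEdef
  have hAc : ∀ x, (A x).card = E := fun x => card_imgE H _ (hφi x) _
  have hInter : ∀ x y, A x ∩ A y = imgE H (φ x) (Finset.univ.filter (fun v => x v = y v)) := by
    intro x y
    ext e
    simp only [hA, imgE, Finset.mem_inter, Finset.mem_filter, Finset.mem_univ, true_and]
    constructor
    · rintro ⟨⟨a, b, hab, he⟩, ⟨c, d, hcd, he'⟩⟩
      refine ⟨a, b, hab, ?_⟩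
      rw [he, Sym2.eq_iff] at he'
      have key : ∀ a c, φ x a = φ y c → x a = y a := by
        intro a c hac
        have := Prod.mk.inj (g.injective hac)
        rw [this.2, this.1]
      rcases he' with ⟨h1, h2⟩ | ⟨h1, h2⟩
      · exact ⟨key _ _ h1, key _ _ h2, he⟩
      · exact ⟨key _ _ h1, key _ _ h2, he⟩
    · rintro ⟨a, b, hab, ha, hb, he⟩
      refine ⟨⟨a, b, hab, he⟩, ⟨a, b, hab, ?_⟩⟩
      rw [he]
      simp only [hφ, ha, hb]
  refine janson_dec h0 h1 A ?_ hK ?_ ⟨fun _ => 0⟩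
  · intro x
    rw [← Finset.card_pos, hAc]
    omega
  · simp_rw [hAc]
    have hNr : (0:ℝ) < N := by exact_mod_cast hN
    have hM : ∑ _x : Fin h → Fin N, p ^ E = (N:ℝ) ^ h * p ^ E := by
      simp
    rw [hM]
    set 𝒰 := (Finset.univ : Finset (Finset (Fin h))).filter (fun U => 1 ≤ eIn H U) with h𝒰
    have hbound : ∑ x, ∑ y, (if Disjoint (A x) (A y) then 0 else p ^ (A x ∪ A y).card)
        ≤ ((N:ℝ) ^ h * p ^ E) ^ 2 * ∑ U ∈ 𝒰, ((N : ℝ) ^ U.card * p ^ eIn H U)⁻¹ := by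
      have hterm : ∀ x y, (if Disjoint (A x) (A y) then 0 else p ^ (A x ∪ A y).card)
          ≤ ∑ U ∈ 𝒰, if ∀ v ∈ U, x v = y v then p ^ E * p ^ E * (p ^ eIn H U)⁻¹ else 0 := by
        intro x y
        have hnn : ∀ U ∈ 𝒰, 0 ≤ if ∀ v ∈ U, x v = y v then p ^ E * p ^ E * (p ^ eIn H U)⁻¹
            else 0 := by
          intro U _
          split_ifs <;> positivity
        split_ifs with hd
        · exact Finset.sum_nonneg hnn
        · have hU : Finset.univ.filter (fun v => x v = y v) ∈ 𝒰 := by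
            rw [h𝒰, Finset.mem_filter]
            refine ⟨Finset.mem_univ _, ?_⟩
            rw [← card_imgE H (φ x) (hφi x), ← hInter]
            rw [Finset.disjoint_iff_inter_eq_empty, ← Finset.card_eq_zero] at hd
            omega
          refine le_trans (le_of_eq ?_) (Finset.single_le_sum hnn hU)
          rw [if_pos (fun v hv => (Finset.mem_filter.1 hv).2)]
          have hc := Finset.card_union_add_card_inter (A x) (A y)
          rw [hInter, card_imgE H _ (hφi x), hAc, hAc] at hc
          rw [← pow_add, ← hc, pow_add, mul_assoc, mul_inv_cancel₀ (by positivity), mul_one]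
      calc _ ≤ ∑ x, ∑ y, ∑ U ∈ 𝒰,
              (if ∀ v ∈ U, x v = y v then p ^ E * p ^ E * (p ^ eIn H U)⁻¹ else 0) :=
            Finset.sum_le_sum fun x _ => Finset.sum_le_sum fun y _ => hterm x y
        _ = ∑ x : Fin h → Fin N, ∑ U ∈ 𝒰, (N:ℝ) ^ (h - U.card) *
              (p ^ E * p ^ E * (p ^ eIn H U)⁻¹) := by
            refine Finset.sum_congr rfl fun x _ => ?_
            rw [Finset.sum_comm]
            refine Finset.sum_congr rfl fun U _ => ?_
            rw [← Finset.sum_filter, Finset.sum_const, count_agree, nsmul_eq_mul]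
            push_cast
            rfl
        _ = _ := by
            rw [Finset.sum_const, nsmul_eq_mul, Finset.mul_sum, Finset.mul_sum]
            refine Finset.sum_congr rfl fun U _ => ?_
            have hUc : U.card ≤ h := by simpa using Finset.card_le_univ U
            have : (N:ℝ) ^ (h - U.card) = (N:ℝ) ^ h * ((N:ℝ) ^ U.card)⁻¹ :=
              pow_sub₀ _ hNr.ne' hUc
            rw [this, mul_inv]
            simp
            ring
    have hpos : 0 ≤ ((N:ℝ) ^ h * p ^ E) ^ 2 := by positivity
    calc _ ≤ K * (((N:ℝ) ^ h * p ^ E) ^ 2 * ∑ U ∈ 𝒰, ((N : ℝ) ^ U.card * p ^ eIn H U)⁻¹) :=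
          mul_le_mul_of_nonneg_left hbound hK.le
      _ = ((N:ℝ) ^ h * p ^ E) ^ 2 * (K * ∑ U ∈ 𝒰, ((N : ℝ) ^ U.card * p ^ eIn H U)⁻¹) := by ring
      _ ≤ ((N:ℝ) ^ h * p ^ E) ^ 2 * 1 := mul_le_mul_of_nonneg_left hsum hpos
      _ = _ := mul_one _

/-! ### Edge counts -/

lemma two_mul_eIn {h : ℕ} (H : SimpleGraph (Fin h)) (U : Finset (Fin h)) :
    2 * eIn H U = ∑ v ∈ U, (U.filter (fun w => H.Adj v w)).card := by
  let HU : SimpleGraph (Fin h) :=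
    { Adj := fun a b => H.Adj a b ∧ a ∈ U ∧ b ∈ U
      symm := ⟨fun a b hab => ⟨hab.1.symm, hab.2.2, hab.2.1⟩⟩
      loopless := ⟨fun a ha => H.loopless.irrefl a ha.1⟩ }
  have h1 := HU.sum_degrees_eq_twice_card_edges
  have h2 : HU.edgeFinset.card = eIn H U := by
    unfold eIn
    congr 1
    ext e
    induction e with
    | _ a b =>
      simp only [SimpleGraph.mem_edgeFinset, SimpleGraph.mem_edgeSet, Finset.mem_filter,
        Finset.mem_univ, true_and, HU]
      constructor
      · rintro ⟨h, ha, hb⟩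
        refine ⟨h, fun v hv => ?_⟩
        rcases Sym2.mem_iff.1 hv with rfl | rfl <;> assumption
      · rintro ⟨h, hv⟩
        exact ⟨h, hv a (by simp), hv b (by simp)⟩
  rw [h2] at h1
  rw [← h1]
  symm
  have h3 : ∀ v, HU.degree v = if v ∈ U then (U.filter (fun w => H.Adj v w)).card else 0 := by
    intro v
    rw [← SimpleGraph.card_neighborFinset_eq_degree]
    split_ifs with hv
    · congr 1
      ext w
      simp [HU, hv, and_comm]
    · rw [Finset.card_eq_zero]
      ext w
      simp [HU, hv]
  simp_rw [h3]
  simp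

lemma deg_le {h Δ : ℕ} (H : SimpleGraph (Fin h)) (hd : maxDegLE H Δ) (v : Fin h) :
    (Finset.univ.filter (fun w => H.Adj v w)).card ≤ Δ := by
  refine le_trans (le_of_eq ?_) (hd v)
  rw [Nat.card_coe_set_eq, ← Set.ncard_coe_finset]
  congr 1
  ext w
  simp

lemma eIn_le_deg {h Δ : ℕ} (H : SimpleGraph (Fin h)) (hd : maxDegLE H Δ) (U : Finset (Fin h)) :
    2 * eIn H U ≤ U.card * Δ := by
  rw [two_mul_eIn, ← smul_eq_mul]
  refine Finset.sum_le_card_nsmul _ _ _ fun v _ => le_trans (Finset.card_le_card ?_) (deg_le H hd v)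
  exact Finset.filter_subset_filter _ (Finset.subset_univ _)

lemma eIn_le_clique {h : ℕ} (H : SimpleGraph (Fin h)) (U : Finset (Fin h)) :
    2 * eIn H U ≤ U.card * (U.card - 1) := by
  rw [two_mul_eIn, ← smul_eq_mul]
  refine Finset.sum_le_card_nsmul _ _ _ fun v hv => ?_
  rw [← Finset.card_erase_of_mem hv]
  refine Finset.card_le_card fun w hw => ?_
  rw [Finset.mem_filter] at hw
  exact Finset.mem_erase.2 ⟨hw.2.ne', hw.1⟩

lemma eIn_lt_conn {h Δ : ℕ} (H : SimpleGraph (Fin h)) (hd : maxDegLE H Δ) (hc : H.Connected)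
    (U : Finset (Fin h)) (hne : U.Nonempty) (hlt : U.card < h) :
    2 * eIn H U + 1 ≤ U.card * Δ := by
  have hex : ∃ v ∈ U, ∃ w ∉ U, H.Adj v w := by
    obtain ⟨a, ha⟩ := hne
    obtain ⟨b, hb⟩ : ∃ b, b ∉ U := by
      by_contra hcon
      push Not at hcon
      have : U = Finset.univ := Finset.eq_univ_iff_forall.2 hcon
      rw [this] at hlt
      simp at hlt
    obtain ⟨w⟩ := hc.preconnected a b
    obtain ⟨d, _, hd1, hd2⟩ := w.exists_boundary_dart (U : Set (Fin h)) (by simpa using ha)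
      (by simpa using hb)
    exact ⟨d.fst, by simpa using hd1, d.snd, by simpa using hd2, d.adj⟩
  obtain ⟨v, hv, w, hw, hvw⟩ := hex
  rw [two_mul_eIn, ← smul_eq_mul, ← Finset.sum_const]
  refine Finset.sum_lt_sum (fun v _ => le_trans (Finset.card_le_card ?_) (deg_le H hd v))
    ⟨v, hv, lt_of_lt_of_le (Finset.card_lt_card ?_) (deg_le H hd v)⟩
  · exact Finset.filter_subset_filter _ (Finset.subset_univ _)
  · rw [Finset.ssubset_iff_of_subset (Finset.filter_subset_filter _ (Finset.subset_univ _))]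
    exact ⟨w, by simpa using hvw, by simp [hw]⟩

lemma two_le_card {h : ℕ} (H : SimpleGraph (Fin h)) (U : Finset (Fin h)) (hU : 1 ≤ eIn H U) :
    2 ≤ U.card := by
  have := eIn_le_clique H U
  by_contra hcon
  have : U.card - 1 = 0 := by omega
  simp_all

/-- Edge bound for small graphs. -/
lemma eIn_bound_small {h Δ : ℕ} (H : SimpleGraph (Fin h)) (U : Finset (Fin h))
    (hU : 1 ≤ eIn H U) (hh : h ≤ Δ + 1) :
    (2 * eIn H U : ℝ) ≤ (Δ + 1) * (U.card - 1) := by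
  have h2 := two_le_card H U hU
  have h3 := eIn_le_clique H U
  have h4 : U.card ≤ h := by simpa using Finset.card_le_univ U
  obtain ⟨u, hu⟩ := Nat.exists_eq_add_of_le h2
  rw [hu] at h3 h4 ⊢
  have e : 2 + u - 1 = u + 1 := by omega
  rw [e] at h3
  have h3' : (2 * eIn H U : ℝ) ≤ (2 + u) * (u + 1) := by exact_mod_cast h3
  have h4' : (2 + u : ℝ) ≤ Δ + 1 := by exact_mod_cast h4.trans hh
  push_cast
  nlinarith

/-- Edge bound for large connected graphs. -/
lemma eIn_bound_large {h Δ : ℕ} (H : SimpleGraph (Fin h)) (U : Finset (Fin h))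
    (hU : 1 ≤ eIn H U) (hh : Δ + 1 < h) (hd : maxDegLE H Δ) (hc : H.Connected) :
    (2 * eIn H U : ℝ) ≤ (Δ + 1) * (U.card - 1) - U.card / (Δ + 2) := by
  have h2 := two_le_card H U hU
  have hD : (0:ℝ) < Δ + 2 := by positivity
  rw [le_sub_iff_add_le, ← le_sub_iff_add_le', div_le_iff₀ hD]
  rcases lt_trichotomy U.card (Δ + 1) with hlt | heq | hgt
  · have h3 := eIn_le_clique H U
    obtain ⟨u, hu⟩ := Nat.exists_eq_add_of_le h2
    rw [hu] at h3 hlt ⊢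
    have e : 2 + u - 1 = u + 1 := by omega
    rw [e] at h3
    have h3' : (2 * eIn H U : ℝ) ≤ (2 + u) * (u + 1) := by exact_mod_cast h3
    have h4' : (2 + u : ℝ) + 1 ≤ Δ + 1 := by exact_mod_cast hlt
    push_cast
    have h5 : (u + 1 : ℝ) ≤ (Δ + 1) * (2 + u - 1) - 2 * eIn H U := by nlinarith
    have h6 : (0:ℝ) ≤ u := by positivity
    nlinarith
  · have h3 := eIn_lt_conn H hd hc U (Finset.card_pos.1 (by omega)) (by omega)
    rw [heq] at h3 ⊢
    have h3' : (2 * eIn H U : ℝ) + 1 ≤ (Δ + 1) * Δ := by exact_mod_cast h3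
    push_cast
    have h5 : (1 : ℝ) ≤ (Δ + 1) * (Δ + 1 - 1) - 2 * eIn H U := by nlinarith
    nlinarith
  · have h3 := eIn_le_deg H hd U
    have h3' : (2 * eIn H U : ℝ) ≤ U.card * Δ := by exact_mod_cast h3
    have h4' : (Δ + 1 + 1 : ℝ) ≤ U.card := by exact_mod_cast hgt
    have h5 : (U.card - Δ - 1 : ℝ) ≤ (Δ + 1) * (U.card - 1) - 2 * eIn H U := by nlinarith
    have h6 : (0:ℝ) ≤ Δ := by positivity
    nlinarith

/-! ### Numerical estimates -/

lemma term_bound {n N u e : ℕ} {p ω c D g : ℝ} (hn : 1 ≤ n) (hω : 1 ≤ ω) (hD : 0 < D)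
    (hc : 0 < c) (hN : (n : ℝ) / c ≤ N) (hp : ω ≤ p * (n : ℝ) ^ (2 / D)) (he : 1 ≤ e)
    (hb : (2 * e : ℝ) ≤ D * (u - 1) - D * g * u) :
    ((N : ℝ) ^ u * p ^ e)⁻¹ ≤ (ω * n)⁻¹ * (c * (n : ℝ) ^ (-g)) ^ u := by
  have hn0 : (0:ℝ) < n := by exact_mod_cast hn
  have hn1 : (1:ℝ) ≤ n := by exact_mod_cast hn
  have hω0 : 0 < ω := by linarith
  have hp' : ω * (n : ℝ) ^ (-(2 / D)) ≤ p := by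
    have h2 : (0:ℝ) < (n : ℝ) ^ (-(2 / D)) := Real.rpow_pos_of_pos hn0 _
    have h3 := mul_le_mul_of_nonneg_right hp h2.le
    rwa [mul_assoc p, ← Real.rpow_add hn0, add_neg_cancel, Real.rpow_zero, mul_one] at h3
  have hng : (0:ℝ) < (n : ℝ) ^ g := Real.rpow_pos_of_pos hn0 _
  have hmain : ω * n * ((n : ℝ) ^ g / c) ^ u ≤ (N : ℝ) ^ u * p ^ e := by
    have a1 : ((n : ℝ) / c) ^ u ≤ (N:ℝ) ^ u := pow_le_pow_left₀ (by positivity) hN u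
    have a2 : (ω * (n : ℝ) ^ (-(2 / D))) ^ e ≤ p ^ e :=
      pow_le_pow_left₀ (by positivity) hp' e
    have a3 : ω * (n : ℝ) ^ (1 - u + g * u : ℝ) ≤ (ω * (n : ℝ) ^ (-(2 / D))) ^ e := by
      rw [mul_pow]
      refine mul_le_mul ?_ ?_ (by positivity) (by positivity)
      · exact le_self_pow₀ hω (by omega)
      · rw [← Real.rpow_mul_natCast hn0.le]
        apply Real.rpow_le_rpow_of_exponent_le hn1
        have : (2 / D * e : ℝ) ≤ (u - 1) - g * u := by
          rw [div_mul_eq_mul_div, div_le_iff₀ hD]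
          linarith
        linarith
    have a4 : ω * n * ((n : ℝ) ^ g / c) ^ u
        = ((n : ℝ) / c) ^ u * (ω * (n : ℝ) ^ (1 - u + g * u : ℝ)) := by
      rw [Real.rpow_add hn0, Real.rpow_sub hn0, Real.rpow_one, Real.rpow_natCast,
        Real.rpow_mul_natCast hn0.le, div_pow, div_pow]
      field_simp
    rw [a4]
    exact mul_le_mul a1 (a3.trans a2) (by positivity) (by positivity)
  have hr : (ω * n)⁻¹ * (c * (n : ℝ) ^ (-g)) ^ u = (ω * n * ((n : ℝ) ^ g / c) ^ u)⁻¹ := by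
    rw [Real.rpow_neg hn0.le, mul_inv (ω * n), ← inv_pow, inv_div]
    rfl
  rw [hr]
  exact inv_anti₀ (by positivity) hmain

lemma single_fail {n h Δ : ℕ} {p ε L : ℝ} (hn : 1 ≤ n) (hε : 0 < ε) (hp1 : p ≤ 1)
    (hp : 4 * (1 + 2 * (Δ + 1) / ε) ^ (Δ + 1) ≤ p * (n : ℝ) ^ ((2 : ℝ) / ((Δ : ℝ) + 1)))
    (H : SimpleGraph (Fin h)) (hc : H.Connected) (hd : maxDegLE H Δ)
    (hL : (h : ℝ) ≤ L) (hL1 : 2 * L ≤ ε * n)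
    (hL2 : 2 / ε * (L ^ 2 * (n : ℝ) ^ (-(1 / (((Δ : ℝ) + 1) * (Δ + 2))))) ≤ 1 / 5)
    (V' : Finset (Fin n)) (hV : ε * n ≤ V'.card) :
    gnpProb n p (fun G => ¬ HasEmb V' H G) ≤ Real.exp (- (2 * n)) := by
  have hn0 : (0:ℝ) < n := by exact_mod_cast hn
  have hh : 1 ≤ h := by
    obtain ⟨v⟩ := hc.nonempty
    have := v.2
    omega
  have hh0 : (0:ℝ) < h := by exact_mod_cast hh
  set ω : ℝ := 4 * (1 + 2 * (Δ + 1) / ε) ^ (Δ + 1) with hω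
  have hω4 : 4 ≤ ω := by
    have : (1:ℝ) ≤ (1 + 2 * (Δ + 1) / ε) ^ (Δ + 1) := by
      apply one_le_pow₀
      have : 0 ≤ 2 * ((Δ:ℝ) + 1) / ε := by positivity
      linarith
    linarith
  have hp0 : 0 < p := by
    by_contra hcon
    push Not at hcon
    have : p * (n : ℝ) ^ ((2 : ℝ) / ((Δ : ℝ) + 1)) ≤ 0 :=
      mul_nonpos_of_nonpos_of_nonneg hcon (by positivity)
    linarith
  set N := V'.card / h with hN
  have hNV : h * N ≤ V'.card := Nat.mul_div_le _ _
  have hV2 : (2 * h : ℝ) ≤ V'.card := by linarith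
  have hlt : (V'.card : ℝ) < h * (N + 1) := by
    have := Nat.lt_mul_div_succ V'.card (show 0 < h by omega)
    exact_mod_cast this
  have hN1 : 1 ≤ N := by
    rw [hN, Nat.le_div_iff_mul_le (by omega)]
    have : 2 * h ≤ V'.card := by exact_mod_cast hV2
    omega
  set c : ℝ := 2 * h / ε with hcdef
  have hc0 : 0 < c := by positivity
  have hNc : (n : ℝ) / c ≤ N := by
    rw [hcdef, div_div_eq_mul_div, div_le_iff₀ (by positivity)]
    nlinarith
  have hD : (0:ℝ) < (Δ : ℝ) + 1 := by positivity
  have hsumpow : ∀ a : ℝ, ∑ U : Finset (Fin h), a ^ U.card = (1 + a) ^ h := by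
    intro a
    have := Fintype.sum_pow_mul_eq_add_pow (Fin h) a 1
    simpa [add_comm] using this
  have key : 4 * (n:ℝ) * ∑ U ∈ (Finset.univ : Finset (Finset (Fin h))).filter
      (fun U => 1 ≤ eIn H U), ((N : ℝ) ^ U.card * p ^ eIn H U)⁻¹ ≤ 1 := by
    by_cases hcase : h ≤ Δ + 1
    · have hs : ∑ U ∈ (Finset.univ : Finset (Finset (Fin h))).filter
          (fun U => 1 ≤ eIn H U), ((N : ℝ) ^ U.card * p ^ eIn H U)⁻¹
          ≤ (ω * n)⁻¹ * (1 + c) ^ h := by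
        rw [← hsumpow, Finset.mul_sum]
        refine le_trans (Finset.sum_le_sum fun U hU => ?_)
          (Finset.sum_le_sum_of_subset_of_nonneg (Finset.filter_subset _ _)
            (fun U _ _ => by positivity))
        have hU1 := (Finset.mem_filter.1 hU).2
        have := term_bound (g := 0) hn (by linarith) hD hc0 hNc hp hU1 (by
          have := eIn_bound_small H U hU1 hcase
          linarith)
        simpa using this
      have hcb : (1 + c) ^ h ≤ (1 + 2 * ((Δ:ℝ) + 1) / ε) ^ (Δ + 1) := by
        have hcc : c ≤ 2 * ((Δ:ℝ) + 1) / ε := by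
          rw [hcdef]
          have : (h:ℝ) ≤ Δ + 1 := by exact_mod_cast hcase
          gcongr
        calc (1 + c) ^ h ≤ (1 + c) ^ (Δ + 1) := pow_le_pow_right₀ (by linarith) hcase
          _ ≤ _ := by gcongr
      calc _ ≤ 4 * (n:ℝ) * ((ω * n)⁻¹ * (1 + c) ^ h) :=
            mul_le_mul_of_nonneg_left hs (by positivity)
        _ = (4 * (1 + c) ^ h) / ω := by field_simp
        _ ≤ 1 := by
          rw [div_le_one (by linarith)]
          linarith
    · set γ : ℝ := 1 / (((Δ : ℝ) + 1) * (Δ + 2)) with hγ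
      set a : ℝ := c * (n:ℝ) ^ (-γ) with ha
      have ha0 : 0 < a := by positivity
      have hs : ∑ U ∈ (Finset.univ : Finset (Finset (Fin h))).filter
          (fun U => 1 ≤ eIn H U), ((N : ℝ) ^ U.card * p ^ eIn H U)⁻¹
          ≤ (n:ℝ)⁻¹ * ((1 + a) ^ h - 1) := by
        have hsub : (1 + a) ^ h - 1 = ∑ U ∈ (Finset.univ : Finset (Finset (Fin h))).erase ∅,
            a ^ U.card := by
          rw [← hsumpow, ← Finset.add_sum_erase _ _ (Finset.mem_univ (∅ : Finset (Fin h)))]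
          simp
        rw [hsub, Finset.mul_sum]
        refine le_trans (Finset.sum_le_sum fun U hU => ?_)
          (Finset.sum_le_sum_of_subset_of_nonneg (fun U hU => ?_)
            (fun U _ _ => by positivity))
        · have hU1 := (Finset.mem_filter.1 hU).2
          have := term_bound (g := γ) hn (by linarith) hD hc0 hNc hp hU1 (by
            have := eIn_bound_large H U hU1 (by omega) hd hc
            have e : ((Δ:ℝ) + 1) * γ * U.card = U.card / (Δ + 2) := by
              rw [hγ]; field_simp
            rw [e]
            exact this)
          refine this.trans ?_
          refine mul_le_mul_of_nonneg_right ?_ (by positivity)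
          apply inv_anti₀ hn0
          nlinarith
        · have hU1 := (Finset.mem_filter.1 hU).2
          rw [Finset.mem_erase]
          refine ⟨?_, Finset.mem_univ _⟩
          rintro rfl
          have := two_le_card H ∅ hU1
          simp at this
      have hah : h * a ≤ 1 / 5 := by
        refine le_trans ?_ hL2
        have : (h:ℝ) * a = 2 / ε * ((h:ℝ) ^ 2 * (n:ℝ) ^ (-γ)) := by
          rw [ha, hcdef]; ring
        rw [this]
        gcongr
      have hexp : (1 + a) ^ h ≤ 5 / 4 := by
        have h1 : 1 + a ≤ Real.exp a := by linarith [Real.add_one_le_exp a]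
        have h2 : (1 + a) ^ h ≤ Real.exp (h * a) := by
          rw [Real.exp_nat_mul]
          exact pow_le_pow_left₀ (by linarith) h1 h
        have h3 : Real.exp (h * a) ≤ Real.exp (1 / 5) := Real.exp_le_exp.2 hah
        have h4 : (4/5 : ℝ) ≤ Real.exp (-(1/5)) := by
          linarith [Real.add_one_le_exp (-(1/5) : ℝ)]
        have h5 : Real.exp (1/5) * Real.exp (-(1/5)) = 1 := by
          rw [← Real.exp_add]; simp
        have h6 := Real.exp_pos (1/5)
        nlinarith
      calc _ ≤ 4 * (n:ℝ) * ((n:ℝ)⁻¹ * ((1 + a) ^ h - 1)) :=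
            mul_le_mul_of_nonneg_left hs (by positivity)
        _ = 4 * ((1 + a) ^ h - 1) := by field_simp
        _ ≤ 1 := by linarith
  have := embed_fail hp0 hp1 hN1 (K := 4 * n) (by positivity) H V' hNV key
  refine this.trans (le_of_eq ?_)
  congr 1
  ring

/-! ### Union bound -/

lemma gnpProb_compl (n : ℕ) (p : ℝ) (P : SimpleGraph (Fin n) → Prop) :
    gnpProb n p P + gnpProb n p (fun G => ¬ P G) = 1 := by
  rw [gnpProb_eq, gnpProb_eq, ← Finset.sum_add_distrib, ← bw_sum (α := Ed n) p]
  refine Finset.sum_congr rfl fun s _ => ?_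
  by_cases h : P (graphEquiv n s) <;> simp [h]

lemma gnpProb_nonneg {n : ℕ} {p : ℝ} (h0 : 0 ≤ p) (h1 : p ≤ 1)
    (P : SimpleGraph (Fin n) → Prop) : 0 ≤ gnpProb n p P := by
  rw [gnpProb_eq]
  refine Finset.sum_nonneg fun s _ => ?_
  split_ifs
  · exact bw_nonneg h0 h1 s
  · exact le_rfl

lemma gnpProb_union {n : ℕ} {p : ℝ} (h0 : 0 ≤ p) (h1 : p ≤ 1) {I : Type*} [Fintype I]
    (P : SimpleGraph (Fin n) → Prop) (Q : I → SimpleGraph (Fin n) → Prop)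
    (hPQ : ∀ G, P G → ∃ i, Q i G) : gnpProb n p P ≤ ∑ i, gnpProb n p (Q i) := by
  simp_rw [gnpProb_eq]
  rw [Finset.sum_comm]
  refine Finset.sum_le_sum fun s _ => ?_
  have hnn : ∀ i ∈ (Finset.univ : Finset I),
      0 ≤ if Q i (graphEquiv n s) then bw p s else 0 := by
    intro i _
    split_ifs
    · exact bw_nonneg h0 h1 s
    · exact le_rfl
  split_ifs with h
  · obtain ⟨i, hi⟩ := hPQ _ h
    refine le_trans (le_of_eq ?_) (Finset.single_le_sum hnn (Finset.mem_univ i))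
    rw [if_pos hi]
  · exact Finset.sum_nonneg hnn

lemma card_graphs (m : ℕ) : Fintype.card (SimpleGraph (Fin m)) ≤ 2 ^ (m ^ 2) := by
  rw [← Fintype.card_congr (graphEquiv m), Fintype.card_finset]
  apply Nat.pow_le_pow_right (by norm_num)
  have h := Sym2.card_subtype_not_diag (α := Fin m)
  rw [Fintype.card_fin] at h
  calc Fintype.card (Ed m) = m.choose 2 := h
    _ ≤ m ^ 2 := Nat.choose_le_pow m 2

lemma all_fail {n Δ k : ℕ} {p ε : ℝ} (hn : 1 ≤ n) (hε : 0 < ε) (hp0 : 0 ≤ p) (hp1 : p ≤ 1)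
    (hp : 4 * (1 + 2 * (Δ + 1) / ε) ^ (Δ + 1) ≤ p * (n : ℝ) ^ ((2 : ℝ) / ((Δ : ℝ) + 1)))
    (hL1 : 2 * (Real.logb 2 n) ^ k ≤ ε * n)
    (hL2 : 2 / ε * (((Real.logb 2 n) ^ k) ^ 2 * (n : ℝ) ^ (-(1 / (((Δ : ℝ) + 1) * (Δ + 2)))))
      ≤ 1 / 5)
    (hL3 : (Real.logb 2 n) ^ k + ((Real.logb 2 n) ^ k) ^ 2 ≤ n) :
    gnpProb n p (fun G => ¬ ∀ V' : Finset (Fin n), ε * n ≤ (V'.card : ℝ) →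
            ∀ (m : ℕ) (H : SimpleGraph (Fin m)),
              (m : ℝ) ≤ (Real.logb 2 n) ^ k → H.Connected → maxDegLE H Δ →
                ∃ f : Fin m → Fin n, Function.Injective f ∧ (∀ a, f a ∈ V') ∧
                  ∀ a b, H.Adj a b → G.Adj (f a) (f b)) ≤ (4 * Real.exp (-2)) ^ n := by
  set L := (Real.logb 2 n) ^ k with hLdef
  have hL0 : 0 ≤ L := by
    have : 0 ≤ Real.logb 2 n := Real.logb_nonneg (by norm_num) (by exact_mod_cast hn)
    positivity
  set M := ⌊L⌋₊ with hM
  have hML : (M : ℝ) ≤ L := Nat.floor_le hL0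
  have hMn : M + M ^ 2 ≤ n := by
    have : (M : ℝ) + (M:ℝ) ^ 2 ≤ n := by
      refine le_trans ?_ hL3
      gcongr
    exact_mod_cast this
  let Q : (Finset (Fin n) × (Σ m : Fin (M + 1), SimpleGraph (Fin m))) →
      SimpleGraph (Fin n) → Prop := fun i G =>
    (ε * n ≤ (i.1.card : ℝ) ∧ ((i.2.1 : ℕ) : ℝ) ≤ L ∧ i.2.2.Connected ∧ maxDegLE i.2.2 Δ) ∧
      ¬ HasEmb i.1 i.2.2 G
  have hQ : ∀ i, gnpProb n p (Q i) ≤ Real.exp (-(2 * n)) := by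
    intro i
    by_cases hi : ε * n ≤ (i.1.card : ℝ) ∧ ((i.2.1 : ℕ) : ℝ) ≤ L ∧ i.2.2.Connected ∧
        maxDegLE i.2.2 Δ
    · have : Q i = fun G => ¬ HasEmb i.1 i.2.2 G := by
        funext G
        simp only [Q, hi, true_and]
      rw [this]
      exact single_fail hn hε hp1 hp i.2.2 hi.2.2.1 hi.2.2.2 hi.2.1 hL1 hL2 i.1 hi.1
    · have : gnpProb n p (Q i) = 0 := by
        unfold gnpProb
        refine Finset.sum_eq_zero fun G _ => ?_
        rw [if_neg]
        exact fun hh => hi hh.1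
      rw [this]
      exact Real.exp_nonneg _
  refine (gnpProb_union hp0 hp1 _ Q ?_).trans ?_
  · intro G hG
    push Not at hG
    obtain ⟨V', hV, m, H, hm, hc, hd, hno⟩ := hG
    have hmM : m ≤ M := Nat.le_floor hm
    refine ⟨⟨V', ⟨⟨m, by omega⟩, H⟩⟩, ⟨hV, hm, hc, hd⟩, ?_⟩
    rintro ⟨f, hf1, hf2, hf3⟩
    obtain ⟨a, b, hab, hnab⟩ := hno f hf1 hf2
    exact hnab (hf3 a b hab)
  · refine (Finset.sum_le_card_nsmul _ _ _ fun i _ => hQ i).trans ?_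
    have hcard : Fintype.card (Finset (Fin n) × (Σ m : Fin (M + 1), SimpleGraph (Fin m)))
        ≤ 4 ^ n := by
      rw [Fintype.card_prod, Fintype.card_finset, Fintype.card_fin, Fintype.card_sigma]
      have : ∑ m : Fin (M + 1), Fintype.card (SimpleGraph (Fin m)) ≤ 2 ^ n := by
        calc _ ≤ ∑ m : Fin (M + 1), 2 ^ (M ^ 2) := by
              refine Finset.sum_le_sum fun m _ => (card_graphs m).trans ?_
              apply Nat.pow_le_pow_right (by norm_num)
              apply Nat.pow_le_pow_left
              have := m.2
              omega
          _ = (M + 1) * 2 ^ (M ^ 2) := by simp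
          _ ≤ 2 ^ M * 2 ^ (M ^ 2) := Nat.mul_le_mul_right _ Nat.lt_two_pow_self
          _ = 2 ^ (M + M ^ 2) := by rw [pow_add]
          _ ≤ 2 ^ n := Nat.pow_le_pow_right (by norm_num) hMn
      calc _ ≤ 2 ^ n * 2 ^ n := Nat.mul_le_mul_left _ this
        _ = 4 ^ n := by rw [← mul_pow]; norm_num
    have hcard' : ((Finset.univ : Finset (Finset (Fin n) ×
        (Σ m : Fin (M + 1), SimpleGraph (Fin m)))).card : ℝ) ≤ 4 ^ n := by
      rw [Finset.card_univ]
      exact_mod_cast hcard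
    rw [nsmul_eq_mul, mul_pow, ← Real.exp_nat_mul]
    have e : (n:ℝ) * -2 = -(2 * n) := by ring
    rw [e]
    exact mul_le_mul_of_nonneg_right hcard' (Real.exp_nonneg _)

lemma log_small (j : ℕ) {r : ℝ} (hr : 0 < r) :
    Tendsto (fun n : ℕ => (Real.logb 2 n) ^ j * (n : ℝ) ^ (-r)) atTop (nhds 0) := by
  have h1 := (isLittleO_log_rpow_rpow_atTop (j : ℝ) hr).tendsto_div_nhds_zero
  have h2 := (h1.comp tendsto_natCast_atTop_atTop).const_mul ((Real.log 2) ^ j)⁻¹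
  rw [mul_zero] at h2
  refine h2.congr fun n => ?_
  simp only [Function.comp, Real.rpow_natCast, Real.logb]
  rw [Real.rpow_neg (Nat.cast_nonneg n), div_pow]
  ring

/-- A.a.s. every induced subgraph of `G(n,p)` on at least `ε n` vertices contains every
connected graph on at most `(log₂ n)^k` vertices with maximum degree at most `Δ`. -/
theorem small_universality_in_subsets
    (ε : ℝ) (hε : 0 < ε) (Δ k : ℕ) (hΔ : 3 ≤ Δ) (hk : 1 ≤ k)
    (p : ℕ → ℝ) (hp : ∀ n, 0 ≤ p n ∧ p n ≤ 1)
    (hgrow : Tendsto (fun n : ℕ => p n * (n : ℝ) ^ ((2 : ℝ) / ((Δ : ℝ) + 1))) atTop atTop) :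
    Tendsto (fun n : ℕ =>
        gnpProb n (p n) (fun G =>
          ∀ V' : Finset (Fin n), ε * n ≤ (V'.card : ℝ) →
            ∀ (m : ℕ) (H : SimpleGraph (Fin m)),
              (m : ℝ) ≤ (Real.logb 2 n) ^ k → H.Connected → maxDegLE H Δ →
                ∃ f : Fin m → Fin n, Function.Injective f ∧ (∀ a, f a ∈ V') ∧
                  ∀ a b, H.Adj a b → G.Adj (f a) (f b)))
      atTop (nhds 1) := by
  set L : ℕ → ℝ := fun n => (Real.logb 2 n) ^ k with hL
  set γ : ℝ := 1 / (((Δ : ℝ) + 1) * (Δ + 2)) with hγ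
  have hγ0 : 0 < γ := by positivity
  have t1 := log_small k one_pos
  have t2 := log_small (k * 2) one_pos
  have t3 := log_small (k * 2) hγ0
  have c1 : ∀ᶠ n : ℕ in atTop, (Real.logb 2 n) ^ k * (n:ℝ) ^ (-1:ℝ) ≤ min (ε / 2) (1 / 2) :=
    t1.eventually_le_const (by positivity)
  have c2 : ∀ᶠ n : ℕ in atTop, (Real.logb 2 n) ^ (k * 2) * (n:ℝ) ^ (-1:ℝ) ≤ 1 / 2 :=
    t2.eventually_le_const (by positivity)
  have c3 : ∀ᶠ n : ℕ in atTop, (Real.logb 2 n) ^ (k * 2) * (n:ℝ) ^ (-γ) ≤ ε / 10 :=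
    t3.eventually_le_const (by positivity)
  have c4 := hgrow.eventually_ge_atTop (4 * (1 + 2 * ((Δ:ℝ) + 1) / ε) ^ (Δ + 1))
  have hlow : Tendsto (fun n : ℕ => 1 - (4 * Real.exp (-2)) ^ n) atTop (nhds 1) := by
    have hlt : 4 * Real.exp (-2) < 1 := by
      have h1 : (2.7:ℝ) < Real.exp 1 := by linarith [Real.exp_one_gt_d9]
      have h2 : Real.exp (-2) * (Real.exp 1 * Real.exp 1) = 1 := by
        rw [← Real.exp_add, ← Real.exp_add]; norm_num
      have h3 := Real.exp_pos (-2)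
      nlinarith
    have := (tendsto_pow_atTop_nhds_zero_of_lt_one (by positivity) hlt).const_sub 1
    simpa using this
  refine tendsto_of_tendsto_of_tendsto_of_le_of_le' hlow tendsto_const_nhds ?_ ?_
  · filter_upwards [c1, c2, c3, c4, eventually_ge_atTop 1] with n c1 c2 c3 c4 hn
    have hn0 : (0:ℝ) < n := by exact_mod_cast hn
    rw [Real.rpow_neg_one, ← div_eq_mul_inv, div_le_iff₀ hn0] at c1 c2
    have c11 : (Real.logb 2 n) ^ k ≤ ε / 2 * n :=
      c1.trans (mul_le_mul_of_nonneg_right (min_le_left _ _) hn0.le)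
    have c12 : (Real.logb 2 n) ^ k ≤ 1 / 2 * n :=
      c1.trans (mul_le_mul_of_nonneg_right (min_le_right _ _) hn0.le)
    rw [pow_mul] at c2 c3
    have hall := all_fail hn hε (hp n).1 (hp n).2 c4 (k := k) (by linarith)
      (by
        calc _ ≤ 2 / ε * (ε / 10) := mul_le_mul_of_nonneg_left c3 (by positivity)
          _ = 1 / 5 := by field_simp; norm_num) (by linarith)
    have hcomp := gnpProb_compl n (p n) (fun G =>
          ∀ V' : Finset (Fin n), ε * n ≤ (V'.card : ℝ) →
            ∀ (m : ℕ) (H : SimpleGraph (Fin m)),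
              (m : ℝ) ≤ (Real.logb 2 n) ^ k → H.Connected → maxDegLE H Δ →
                ∃ f : Fin m → Fin n, Function.Injective f ∧ (∀ a, f a ∈ V') ∧
                  ∀ a b, H.Adj a b → G.Adj (f a) (f b))
    linarith
  · filter_upwards with n
    have hcomp := gnpProb_compl n (p n) (fun G =>
          ∀ V' : Finset (Fin n), ε * n ≤ (V'.card : ℝ) →
            ∀ (m : ℕ) (H : SimpleGraph (Fin m)),
              (m : ℝ) ≤ (Real.logb 2 n) ^ k → H.Connected → maxDegLE H Δ →
                ∃ f : Fin m → Fin n, Function.Injective f ∧ (∀ a, f a ∈ V') ∧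
                  ∀ a b, H.Adj a b → G.Adj (f a) (f b))
    have := gnpProb_nonneg (hp n).1 (hp n).2 (fun G : SimpleGraph (Fin n) => ¬
          ∀ V' : Finset (Fin n), ε * n ≤ (V'.card : ℝ) →
            ∀ (m : ℕ) (H : SimpleGraph (Fin m)),
              (m : ℝ) ≤ (Real.logb 2 n) ^ k → H.Connected → maxDegLE H Δ →
                ∃ f : Fin m → Fin n, Function.Injective f ∧ (∀ a, f a ∈ V') ∧
                  ∀ a b, H.Adj a b → G.Adj (f a) (f b))
    linarith
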